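/- For the 2-qubit erasure channel with output W_m = block-diag((1−ε)|φ_m⟩⟨φ_m|, ε) ∈ ℂ^{5×5} (0 ≤ ε ≤ 1) applied to the Bell code states (M ≥ 4), the POVM Π_m = (1/M)·block-diag(4|φ_m⟩⟨φ_m|, 1) satisfies the HYKL optimality conditions, and the minimum average error probability equals 1 − (4 − 3ε)/M. -/

import Mathlib

open ComplexOrder

/-- The `M = 2K` generalized Bell vectors in `ℂ⁴`: for `k = 0,…,K−1`,
the vector with index `2k` (the paper's `1+2k`) is `(|00⟩ + e^{2πik/K}|11⟩)/√2`
and the one with index `2k+1` (the paper's `2+2k`) is `(|01⟩ + e^{2πik/K}|10⟩)/√2`. -/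
noncomputable def bell (K : ℕ) (m : Fin (2 * K)) : Fin 4 → ℂ :=
  let k : ℕ := m.val / 2
  let ω : ℂ := Complex.exp (2 * Real.pi * Complex.I * k / K)
  if m.val % 2 = 0 then
    ![1 / (Real.sqrt 2 : ℂ), 0, 0, ω / (Real.sqrt 2 : ℂ)]
  else
    ![0, 1 / (Real.sqrt 2 : ℂ), ω / (Real.sqrt 2 : ℂ), 0]

theorem Fin.sum_univ_two_mul {A : Type*} [AddCommMonoid A] (K : ℕ) (f : ℕ → A) :
    ∑ m : Fin (2 * K), f m = ∑ k ∈ Finset.range K, (f (2 * k) + f (2 * k + 1)) := by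
  rw [Fin.sum_univ_eq_sum_range]
  induction K with
  | zero => simp
  | succ n ih =>
    rw [Finset.sum_range_succ, ← ih, show 2 * (n + 1) = 2 * n + 1 + 1 by ring,
      Finset.sum_range_succ, Finset.sum_range_succ, add_assoc]

theorem Matrix.fromBlocks_sum {ι l m n o A : Type*} [AddCommMonoid A] (s : Finset ι)
    (a : ι → Matrix n l A) (b : ι → Matrix n m A) (c : ι → Matrix o l A) (d : ι → Matrix o m A) :
    ∑ i ∈ s, Matrix.fromBlocks (a i) (b i) (c i) (d i) =
      Matrix.fromBlocks (∑ i ∈ s, a i) (∑ i ∈ s, b i) (∑ i ∈ s, c i) (∑ i ∈ s, d i) := by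
  ext i j
  rcases i with i | i <;> rcases j with j | j <;> simp [Matrix.sum_apply]

theorem Matrix.PosSemidef.trace_mul_nonneg {n : Type*} [Fintype n] [DecidableEq n]
    {A B : Matrix n n ℂ} (hA : A.PosSemidef) (hB : B.PosSemidef) : 0 ≤ (A * B).trace := by
  open scoped MatrixOrder in
  obtain ⟨R, rfl⟩ := CStarAlgebra.nonneg_iff_eq_star_mul_self.mp hA.nonneg
  rw [Matrix.star_eq_conjTranspose, Matrix.mul_assoc, Matrix.trace_mul_comm]
  exact (hB.mul_mul_conjTranspose_same R).trace_nonneg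

theorem Complex.star_exp_mul_exp_two_pi (k K : ℕ) :
    Complex.exp (2 * Real.pi * Complex.I * k / K) *
      star (Complex.exp (2 * Real.pi * Complex.I * k / K)) = 1 := by
  rw [Complex.star_def, ← Complex.exp_conj, ← Complex.exp_add]
  simp [Complex.conj_ofReal, neg_div, show (starRingEnd ℂ) 2 = 2 from Complex.conj_ofNat 2]

theorem Complex.sum_exp_two_pi_eq_zero (K : ℕ) (hK : 2 ≤ K) :
    ∑ k ∈ Finset.range K, Complex.exp (2 * Real.pi * Complex.I * k / K) = 0 := by
  rw [← (Complex.isPrimitiveRoot_exp K (by omega)).geom_sum_eq_zero (by omega)]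
  refine Finset.sum_congr rfl fun k _ => ?_
  rw [← Complex.exp_nat_mul]
  congr 1
  ring

theorem Complex.inv_sqrt_two_mul_self : ((Real.sqrt 2 : ℂ))⁻¹ * (Real.sqrt 2 : ℂ)⁻¹ = 1 / 2 := by
  rw [← mul_inv, ← Complex.ofReal_mul, Real.mul_self_sqrt (by norm_num)]
  norm_num

/-- The rank-one matrix `|φ_m⟩⟨φ_m|`. -/
noncomputable def bellProj (K : ℕ) (m : Fin (2 * K)) : Matrix (Fin 4) (Fin 4) ℂ :=
  Matrix.vecMulVec (bell K m) (star (bell K m))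

theorem star_bell_dotProduct_bell (K : ℕ) (m : Fin (2 * K)) :
    star (bell K m) ⬝ᵥ bell K m = 1 := by
  have h := Complex.star_exp_mul_exp_two_pi (m.val / 2) K
  have h2 := Complex.inv_sqrt_two_mul_self
  simp only [Complex.star_def] at h
  unfold bell
  split_ifs <;> simp [dotProduct, Fin.sum_univ_four, div_eq_mul_inv] at h ⊢ <;>
    linear_combination 2 * h2 + (Real.sqrt 2 : ℂ)⁻¹ * (Real.sqrt 2 : ℂ)⁻¹ * h

theorem bellProj_mul_self (K : ℕ) (m : Fin (2 * K)) :
    bellProj K m * bellProj K m = bellProj K m := by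
  rw [bellProj, Matrix.vecMulVec_mul_vecMulVec, star_bell_dotProduct_bell, one_smul]

theorem conjTranspose_bellProj (K : ℕ) (m : Fin (2 * K)) :
    (bellProj K m).conjTranspose = bellProj K m := by
  rw [bellProj, Matrix.conjTranspose_vecMulVec, star_star]

theorem bellProj_even_add_odd (K k : ℕ) (h₀ : 2 * k < 2 * K) (h₁ : 2 * k + 1 < 2 * K) :
    bellProj K ⟨2 * k, h₀⟩ + bellProj K ⟨2 * k + 1, h₁⟩ =
      (1 / 2 : ℂ) • 1 +
      Complex.exp (2 * Real.pi * Complex.I * k / K) •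
        !![0, 0, 0, 0; 0, 0, 0, 0; 0, 1 / 2, 0, 0; 1 / 2, 0, 0, 0] +
      star (Complex.exp (2 * Real.pi * Complex.I * k / K)) •
        !![0, 0, 0, 1 / 2; 0, 0, 1 / 2, 0; 0, 0, 0, 0; 0, 0, 0, 0] := by
  have h := Complex.star_exp_mul_exp_two_pi k K
  have h2 := Complex.inv_sqrt_two_mul_self
  have e₀ : bell K ⟨2 * k, h₀⟩ = ![(Real.sqrt 2 : ℂ)⁻¹, 0, 0,
      Complex.exp (2 * Real.pi * Complex.I * k / K) * (Real.sqrt 2 : ℂ)⁻¹] := by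
    simp [bell, div_eq_mul_inv]
  have e₁ : bell K ⟨2 * k + 1, h₁⟩ = ![0, (Real.sqrt 2 : ℂ)⁻¹,
      Complex.exp (2 * Real.pi * Complex.I * k / K) * (Real.sqrt 2 : ℂ)⁻¹, 0] := by
    have : (2 * k + 1) / 2 = k := by omega
    have h' : (2 * k + 1) % 2 = 1 := by omega
    simp [bell, div_eq_mul_inv, this, h']
  rw [bellProj, bellProj, e₀, e₁]
  generalize Complex.exp (2 * Real.pi * Complex.I * k / K) = w at *
  generalize hr : (Real.sqrt 2 : ℂ)⁻¹ = r at *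
  have hs : star r = r := by simp [← hr, Complex.conj_ofReal]
  simp only [Complex.star_def] at h hs
  ext i j
  simp only [Matrix.add_apply, Matrix.smul_apply, Matrix.vecMulVec_apply, Pi.star_apply]
  fin_cases i <;> fin_cases j <;> simp [hs] <;>
    first
    | linear_combination h2
    | linear_combination w * h2
    | linear_combination (starRingEnd ℂ) w * h2
    | linear_combination w * (starRingEnd ℂ) w * h2 + (1 / 2) * h

theorem sum_bellProj (K : ℕ) (hK : 2 ≤ K) :
    ∑ m, bellProj K m = ((K : ℂ) / 2) • (1 : Matrix (Fin 4) (Fin 4) ℂ) := by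
  have h := Fin.sum_univ_two_mul K
    (fun i => if hi : i < 2 * K then bellProj K ⟨i, hi⟩ else 0)
  simp only [Fin.is_lt, dite_true, Fin.eta] at h
  rw [h, Finset.sum_congr rfl fun k hk => by
    have := Finset.mem_range.mp hk
    rw [dif_pos (by omega), dif_pos (by omega), bellProj_even_add_odd]]
  rw [Finset.sum_add_distrib, Finset.sum_add_distrib, ← Finset.sum_smul, ← Finset.sum_smul,
    ← Finset.sum_smul, ← star_sum, Complex.sum_exp_two_pi_eq_zero K hK]
  simp [← Nat.cast_smul_eq_nsmul ℂ, div_eq_mul_inv]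

/-- The Holevo–Yuen–Kennedy–Lax conditions are sufficient for optimality of a measurement. -/
theorem sum_trace_mul_le_trace {ι n : Type*} [Fintype ι] [Fintype n] [DecidableEq n]
    {L : Matrix n n ℂ} {V Q : ι → Matrix n n ℂ} (hL : ∀ i, (L - V i).PosSemidef)
    (hQ : ∀ i, (Q i).PosSemidef) (hsum : ∑ i, Q i = 1) :
    ∑ i, (V i * Q i).trace ≤ L.trace := by
  have h : L.trace = ∑ i, (L * Q i).trace := by
    rw [← Matrix.trace_sum, ← Finset.mul_sum, hsum, mul_one]
  rw [h]
  refine Finset.sum_le_sum fun i _ => sub_nonneg.mp ?_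
  rw [← Matrix.trace_sub, ← sub_mul]
  exact (hL i).trace_mul_nonneg (hQ i)

/-- For the 2-qubit erasure channel `W_m = diag((1−ε)|φ_m⟩⟨φ_m|, ε)` applied to the
Bell code (`M = 2K ≥ 4`), the POVM `Π_m = (1/M) diag(4|φ_m⟩⟨φ_m|, 1)` satisfies the
HYKL optimality conditions, and the minimum average error probability equals
`1 − (4 − 3ε)/M`. -/
theorem bell_code_erasure (K : ℕ) (hK : 2 ≤ K)
    (ε : ℝ) (hε0 : 0 ≤ ε) (hε1 : ε ≤ 1)
    (W Pov : Fin (2 * K) → Matrix (Fin 4 ⊕ Fin 1) (Fin 4 ⊕ Fin 1) ℂ)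
    (hWdef : ∀ m, W m = Matrix.fromBlocks
      ((1 - (ε : ℂ)) • Matrix.vecMulVec (bell K m) (star (bell K m))) 0 0
      ((ε : ℂ) • (1 : Matrix (Fin 1) (Fin 1) ℂ)))
    (hPovdef : ∀ m, Pov m = (1 / ((2 * K : ℕ) : ℂ)) • Matrix.fromBlocks
      ((4 : ℂ) • Matrix.vecMulVec (bell K m) (star (bell K m))) 0 0
      (1 : Matrix (Fin 1) (Fin 1) ℂ))
    (Λ : Matrix (Fin 4 ⊕ Fin 1) (Fin 4 ⊕ Fin 1) ℂ)
    (hΛdef : Λ = ∑ m, (1 / ((2 * K : ℕ) : ℂ)) • (W m * Pov m)) :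
    (∀ m, (Pov m).PosSemidef) ∧
    (∑ m, Pov m = 1) ∧
    Λ.IsHermitian ∧
    (∀ m, (Λ - (1 / ((2 * K : ℕ) : ℂ)) • W m) * Pov m = 0) ∧
    (∀ m, (Λ - (1 / ((2 * K : ℕ) : ℂ)) • W m).PosSemidef) ∧
    IsLeast {e : ℂ | ∃ Q : Fin (2 * K) → Matrix (Fin 4 ⊕ Fin 1) (Fin 4 ⊕ Fin 1) ℂ,
        (∀ i, (Q i).PosSemidef) ∧ (∑ i, Q i = 1) ∧
        e = 1 - ∑ m, (1 / ((2 * K : ℕ) : ℂ)) * (W m * Q m).trace}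
      (1 - (4 - 3 * (ε : ℂ)) / ((2 * K : ℕ) : ℂ)) := by
  have hKC : (K : ℂ) ≠ 0 := Nat.cast_ne_zero.mpr (by omega)
  have hW : ∀ m, W m = Matrix.fromBlocks ((1 - (ε : ℂ)) • bellProj K m) 0 0
      ((ε : ℂ) • (1 : Matrix (Fin 1) (Fin 1) ℂ)) := hWdef
  have hPov : ∀ m, Pov m = (1 / ((2 * K : ℕ) : ℂ)) • Matrix.fromBlocks
      ((4 : ℂ) • bellProj K m) 0 0 (1 : Matrix (Fin 1) (Fin 1) ℂ) := hPovdef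
  have hΛ : Λ = (1 / ((2 * K : ℕ) : ℂ)) • Matrix.fromBlocks
      ((1 - (ε : ℂ)) • (1 : Matrix (Fin 4) (Fin 4) ℂ)) 0 0
      ((ε : ℂ) • (1 : Matrix (Fin 1) (Fin 1) ℂ)) := by
    have hWPov : ∀ m, W m * Pov m = (1 / ((2 * K : ℕ) : ℂ)) • Matrix.fromBlocks
        ((4 * (1 - (ε : ℂ))) • bellProj K m) 0 0
        ((ε : ℂ) • (1 : Matrix (Fin 1) (Fin 1) ℂ)) := fun m => by
      rw [hW, hPov, mul_smul_comm, Matrix.fromBlocks_multiply]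
      simp [smul_smul, bellProj_mul_self]
    rw [hΛdef, ← Finset.smul_sum]
    congr 1
    simp only [hWPov, ← Finset.smul_sum, Matrix.fromBlocks_sum, sum_bellProj K hK,
      Matrix.fromBlocks_smul]
    rw [Matrix.fromBlocks_inj]
    simp only [Finset.sum_const_zero, smul_zero, Finset.card_univ, Fintype.card_fin,
      Finset.sum_const, ← Nat.cast_smul_eq_nsmul ℂ, smul_smul, true_and]
    constructor <;> congr 1 <;> push_cast <;> field
  have hM : (0 : ℂ) ≤ 1 / ((2 * K : ℕ) : ℂ) :=
    div_nonneg zero_le_one (Nat.cast_nonneg _)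
  have hε : (0 : ℂ) ≤ 1 - (ε : ℂ) := by
    rw [sub_nonneg]; exact_mod_cast hε1
  have hPovPos : ∀ m, (Pov m).PosSemidef := fun m => by
    have h := Matrix.posSemidef_conjTranspose_mul_self (Matrix.fromBlocks
      ((2 : ℂ) • bellProj K m) 0 0 (1 : Matrix (Fin 1) (Fin 1) ℂ))
    rw [hPov]
    refine Matrix.PosSemidef.smul ?_ hM
    convert h using 1
    simp [Matrix.fromBlocks_conjTranspose, Matrix.fromBlocks_multiply, bellProj_mul_self,
      conjTranspose_bellProj, smul_smul]
    norm_num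
  have hPovSum : ∑ m, Pov m = 1 := by
    simp only [hPov, ← Finset.smul_sum, Matrix.fromBlocks_sum, sum_bellProj K hK,
      Matrix.fromBlocks_smul]
    rw [← Matrix.fromBlocks_one, Matrix.fromBlocks_inj]
    simp [-Matrix.fromBlocks_one, smul_smul, ← Nat.cast_smul_eq_nsmul ℂ]
    constructor
    · convert one_smul ℂ (1 : Matrix (Fin 4) (Fin 4) ℂ) using 2
      field_simp; norm_num
    · convert one_smul ℂ (1 : Matrix (Fin 1) (Fin 1) ℂ) using 2
      field_simp
  have hdiff : ∀ m, Λ - (1 / ((2 * K : ℕ) : ℂ)) • W m = (1 / ((2 * K : ℕ) : ℂ)) •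
      (1 - (ε : ℂ)) • Matrix.fromBlocks (1 - bellProj K m) 0 0
        (0 : Matrix (Fin 1) (Fin 1) ℂ) := fun m => by
    rw [hΛ, hW, ← smul_sub, sub_eq_add_neg (Matrix.fromBlocks _ _ _ _), Matrix.fromBlocks_neg,
      Matrix.fromBlocks_add, Matrix.fromBlocks_smul (1 - (ε : ℂ))]
    simp [sub_eq_add_neg]
  have hpos : ∀ m, (Λ - (1 / ((2 * K : ℕ) : ℂ)) • W m).PosSemidef := fun m => by
    have h := Matrix.posSemidef_conjTranspose_mul_self (Matrix.fromBlocks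
      (1 - bellProj K m) 0 0 (0 : Matrix (Fin 1) (Fin 1) ℂ))
    rw [hdiff]
    refine Matrix.PosSemidef.smul (Matrix.PosSemidef.smul ?_ hε) hM
    convert h using 1
    simp [Matrix.fromBlocks_conjTranspose, Matrix.fromBlocks_multiply, bellProj_mul_self,
      conjTranspose_bellProj, sub_mul, mul_sub]
  have htrace : Λ.trace = (4 - 3 * (ε : ℂ)) / ((2 * K : ℕ) : ℂ) := by
    rw [hΛ]
    simp [Matrix.trace]
    ring
  refine ⟨hPovPos, hPovSum, ?_, fun m => ?_, hpos, ⟨Pov, hPovPos, hPovSum, ?_⟩, ?_⟩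
  · rw [hΛ, Matrix.IsHermitian]
    simp [Matrix.fromBlocks_conjTranspose, Complex.conj_ofReal]
  · rw [hdiff, hPov]
    simp [Matrix.fromBlocks_multiply, sub_mul, bellProj_mul_self]
  · rw [← htrace, hΛdef, Matrix.trace_sum]
    simp only [Matrix.trace_smul, smul_eq_mul]
  · rintro e ⟨Q, hQ, hQsum, rfl⟩
    have h := sum_trace_mul_le_trace hpos hQ hQsum
    rw [htrace] at h
    simp only [Matrix.smul_mul, Matrix.trace_smul, smul_eq_mul] at h
    exact sub_le_sub_left h 1
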